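/- Let I be a nonempty set, ξ an ordinal, 1 < p < ∞, and for each i ∈ I let Aᵢ : Xᵢ → Yᵢ be an operator with sup_{i∈I} ‖Aᵢ‖ < ∞. Define A : (⊕_{i∈I} Xᵢ)_{ℓ_p(I)} → (⊕_{i∈I} Yᵢ)_{ℓ_p(I)} coordinatewise by A|_{Xᵢ} = Aᵢ. Then t_{ξ,p}(A) ≤ sup_{i∈I} max{t_{ξ,p}(Aᵢ), ‖Aᵢ‖}, where t_{ξ,p} is the ξ-p-asymptotic smoothness constant. -/

import Mathlib

open Ordinal Filter

namespace PaperAUS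

/-- A tree on `Λ`: a set of nonempty finite sequences closed under nonempty initial segments. -/
def IsTree {Λ : Type*} (T : Set (List Λ)) : Prop :=
  [] ∉ T ∧ ∀ s t : List Λ, t ∈ T → s <+: t → s ≠ [] → s ∈ T

/-- The maximal nodes of `T`: those with no proper extension in `T`. -/
def maxNodes {Λ : Type*} (T : Set (List Λ)) : Set (List Λ) :=
  {t ∈ T | ∀ s ∈ T, t <+: s → s = t}

/-- Transfinite derivatives of a tree, removing maximal nodes at each step. -/
noncomputable def derivIter {Λ : Type*} (T : Set (List Λ)) (ξ : Ordinal) : Set (List Λ) :=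
  Ordinal.limitRecOn ξ T (fun _ ih => ih \ maxNodes ih)
    (fun o _ ih => ⋂ ζ : Set.Iio o, ih ζ ζ.2)

/-- The rank `o(T)` of a (well-founded) tree: least `ξ` with `T^ξ = ∅`. -/
noncomputable def treeRank {Λ : Type*} (T : Set (List Λ)) : Ordinal :=
  sInf {ξ | derivIter T ξ = ∅}

/-- `T.D`: the tree of sequences of pairs whose first coordinates form a member of `T`. -/
def TD {Λ : Type*} (T : Set (List Λ)) (D : Type*) : Set (List (Λ × D)) :=
  {l | l.map Prod.fst ∈ T}

/-- `r` is (the order of) a directed set. -/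
def IsDirSys {D : Type*} (r : D → D → Prop) : Prop :=
  (∀ a, r a a) ∧ (∀ a b c, r a b → r b c → r a c) ∧ ∀ a b, ∃ c, r a c ∧ r b c

/-- The filter of eventual sections of a directed order, used to express convergence of nets. -/
def netFilter {D : Type*} (r : D → D → Prop) : Filter D :=
  ⨅ a, Filter.principal {b | r a b}

/-- A collection `(x_t)_{t ∈ T.D}` is weakly null: along every family of immediate successor
nodes, the corresponding net is weakly null. -/
def WeaklyNullColl {Λ D : Type*} {X : Type*} [NormedAddCommGroup X] [NormedSpace ℝ X]
    (T : Set (List Λ)) (r : D → D → Prop) (x : List (Λ × D) → X) : Prop :=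
  ∀ (t : List (Λ × D)) (ζ : Λ), (∀ u : D, t ++ [(ζ, u)] ∈ TD T D) →
    ∀ f : X →L[ℝ] ℝ, Tendsto (fun u : D => f (x (t ++ [(ζ, u)]))) (netFilter r) (nhds 0)

/-- The set `{x_s : ∅ < s ≤ t}` of members of the collection along the branch below `t`. -/
def branchSet {Λ D : Type*} {X : Type*} (x : List (Λ × D) → X) (t : List (Λ × D)) : Set X :=
  {v | ∃ s, s ≠ [] ∧ s <+: t ∧ v = x s}

/-- The `ξ`-asymptotic smoothness modulus `ϱ_ξ(σ, A)` of an operator. -/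
noncomputable def rho {X Y : Type*} [NormedAddCommGroup X] [NormedSpace ℝ X]
    [NormedAddCommGroup Y] [NormedSpace ℝ Y] (ξ : Ordinal) (A : X →L[ℝ] Y) (σ : ℝ) : ℝ :=
  sSup {ρ : ℝ | ∃ (Λ D : Type) (r : D → D → Prop) (T : Set (List Λ))
    (y : Y) (x : List (Λ × D) → X),
    Nonempty D ∧ IsDirSys r ∧ IsTree T ∧ treeRank T = omega0 ^ ξ ∧
    ‖y‖ ≤ 1 ∧ (∀ t ∈ TD T D, ‖x t‖ ≤ σ) ∧ WeaklyNullColl T r x ∧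
    ρ = sInf {c : ℝ | ∃ t ∈ TD T D, ∃ v ∈ convexHull ℝ (branchSet x t), c = ‖y + A v‖ - 1}}

end PaperAUS
namespace PaperAUS

/-- `C` witnesses the defining inequality of the `ξ`-`p` asymptotic smoothness constant
`t_{ξ,p}(A)`. -/
def tAdmissible {X Y : Type*} [NormedAddCommGroup X] [NormedSpace ℝ X]
    [NormedAddCommGroup Y] [NormedSpace ℝ Y]
    (ξ : Ordinal) (p : ℝ) (A : X →L[ℝ] Y) (C : ℝ) : Prop :=
  ∀ σ : ℝ, 0 ≤ σ → ∀ y : Y, ∀ (Λ D : Type) (r : D → D → Prop) (T : Set (List Λ))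
    (x : List (Λ × D) → X), Nonempty D → IsDirSys r → IsTree T →
    treeRank T = omega0 ^ ξ → (∀ t ∈ TD T D, ‖x t‖ ≤ σ) → WeaklyNullColl T r x →
    sInf {c : ℝ | ∃ t ∈ TD T D, ∃ v ∈ convexHull ℝ (branchSet x t), c = ‖y + A v‖ ^ p}
      ≤ ‖y‖ ^ p + C ^ p * σ ^ p

/-- The `ξ`-`p` asymptotic smoothness constant `t_{ξ,p}(A)`, with value `∞` if no constant
works. -/
noncomputable def tConst {X Y : Type*} [NormedAddCommGroup X] [NormedSpace ℝ X]
    [NormedAddCommGroup Y] [NormedSpace ℝ Y]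
    (ξ : Ordinal) (p : ℝ) (A : X →L[ℝ] Y) : ENNReal :=
  sInf {e : ENNReal | ∃ C : ℝ, 0 < C ∧ tAdmissible ξ p A C ∧ e = ENNReal.ofReal C}

universe v

/-- Hessenberg-type sum of a finite tuple of ordinals. -/
noncomputable def nsum {K : Type} [Finite K] [DecidableEq K] : (K → Ordinal.{v}) → Ordinal.{v} :=
  WellFounded.fix (wellFounded_lt (α := K → Ordinal.{v})) fun ρ ih =>
    sInf {γ | ∀ (c : K) (β : Ordinal.{v}) (h : β < ρ c),
      ih (Function.update ρ c β) (update_lt_self_iff.2 h) < γ}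

lemma nsum_eq {K : Type} [Finite K] [DecidableEq K] (ρ : K → Ordinal.{v}) :
    nsum ρ = sInf {γ | ∀ (c : K) (β : Ordinal.{v}), β < ρ c →
      nsum (Function.update ρ c β) < γ} := by
  conv_lhs => rw [nsum, WellFounded.fix_eq]
  rfl

lemma nsum_le {K : Type} [Finite K] [DecidableEq K] {ρ : K → Ordinal.{v}} {γ : Ordinal.{v}}
    (h : ∀ (c : K) (β : Ordinal.{v}), β < ρ c → nsum (Function.update ρ c β) < γ) :
    nsum ρ ≤ γ := by
  rw [nsum_eq]
  exact csInf_le' h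

lemma nsum_update_lt {K : Type} [Finite K] [DecidableEq K] {ρ : K → Ordinal.{v}} {c : K}
    {β : Ordinal.{v}} (h : β < ρ c) : nsum (Function.update ρ c β) < nsum ρ := by
  have hne : {γ | ∀ (c : K) (β : Ordinal.{v}), β < ρ c →
      nsum (Function.update ρ c β) < γ}.Nonempty := by
    have hb := Ordinal.bddAbove_of_small.{v} (s := Set.range
      (fun z : (Σ c : K, Set.Iio (ρ c)) => nsum (Function.update ρ z.1 z.2.1)))
    obtain ⟨γ, hγ⟩ := hb
    exact ⟨Order.succ γ, fun c β h => Order.lt_succ_iff.2 (hγ ⟨⟨c, β, h⟩, rfl⟩)⟩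
  rw [nsum_eq ρ]
  exact csInf_mem hne c β h

lemma le_nsum {K : Type} [Finite K] [DecidableEq K] (c : K) (a : Ordinal.{v}) :
    ∀ (ρ : K → Ordinal.{v}), a ≤ ρ c → a ≤ nsum ρ := by
  induction a using WellFoundedLT.induction with
  | ind a ih =>
    intro ρ h
    refine le_of_forall_lt fun b hb => ?_
    exact (ih b hb (Function.update ρ c b) (by simp)).trans_lt (nsum_update_lt (hb.trans_le h))

lemma nsum_mod {K : Type} [Fintype K] [DecidableEq K] (θ : Ordinal.{v}) (hθ : 0 < θ)
    (H : ∀ ρ : K → Ordinal.{v}, (∀ c, ρ c < θ) → nsum ρ < θ) (ρ : K → Ordinal.{v}) :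
    ∀ n : K → ℕ, (∀ c, ρ c / θ = n c) →
      nsum ρ ≤ θ * ((∑ c, n c : ℕ) : Ordinal.{v}) + nsum (fun c => ρ c % θ) := by
  induction ρ using WellFoundedLT.induction with
  | ind ρ ih =>
    intro n hn
    apply nsum_le
    intro c β hβ
    have hle : β / θ ≤ n c := by rw [← hn]; exact Ordinal.div_le_left hβ.le θ
    obtain ⟨m, hm⟩ := Ordinal.lt_omega0.1 (hle.trans_lt (Ordinal.natCast_lt_omega0 _))
    have hmn : m ≤ n c := by rw [hm] at hle; exact_mod_cast hle
    have h1 := ih (Function.update ρ c β) (update_lt_self_iff.2 hβ) (Function.update n c m) (by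
      intro d
      by_cases hd : d = c
      · subst hd; simpa using hm
      · simp [hd, hn])
    refine h1.trans_lt ?_
    rcases hmn.eq_or_lt with e | hlt
    · have : (fun d => Function.update ρ c β d % θ)
          = Function.update (fun d => ρ d % θ) c (β % θ) := by
        funext d
        by_cases hd : d = c
        · subst hd; simp
        · simp [hd]
      rw [this, e, Function.update_eq_self]
      have h2 : β % θ < ρ c % θ := by
        have e1 := Ordinal.div_add_mod β θ
        have e2 := Ordinal.div_add_mod (ρ c) θ
        rw [hm, e] at e1
        rw [hn] at e2
        rw [← e1, ← e2] at hβ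
        exact lt_of_add_lt_add_left hβ
      have := nsum_update_lt (ρ := fun d => ρ d % θ) (c := c) h2
      gcongr
    · have h3 : nsum (fun d => Function.update ρ c β d % θ) < θ :=
        H _ fun d => Ordinal.mod_lt _ hθ.ne'
      have h4 : (∑ d, Function.update n c m d) + 1 ≤ ∑ d, n d := by
        apply Nat.succ_le_of_lt
        refine Finset.sum_lt_sum (fun d _ => ?_) ⟨c, Finset.mem_univ _, by simpa using hlt⟩
        by_cases hd : d = c
        · subst hd; simpa using hmn
        · simp [hd]
      calc _ < θ * ((∑ d, Function.update n c m d : ℕ) : Ordinal.{v}) + θ := by gcongr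
        _ = θ * (((∑ d, Function.update n c m d) + 1 : ℕ) : Ordinal.{v}) := by
          push_cast; rw [mul_add_one]
        _ ≤ θ * ((∑ d, n d : ℕ) : Ordinal.{v}) := by
          gcongr
        _ ≤ _ := le_self_add

lemma nsum_lt_opow {K : Type} [Fintype K] [DecidableEq K] (ξ : Ordinal.{v}) :
    ∀ ρ : K → Ordinal.{v}, (∀ c, ρ c < ω ^ ξ) → nsum ρ < ω ^ ξ := by
  induction ξ using Ordinal.limitRecOn with
  | zero =>
    intro ρ h
    simp only [opow_zero, Order.lt_one_iff] at h ⊢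
    refine le_antisymm (nsum_le fun c β hβ => ?_) zero_le
    rw [h c] at hβ
    exact absurd hβ not_lt_zero
  | add_one ξ ih =>
    intro ρ h
    have hθ : 0 < (ω : Ordinal.{v}) ^ ξ := opow_pos _ omega0_pos
    have h1 : ∀ c, ∃ n : ℕ, ρ c / ω ^ ξ = n := by
      intro c
      apply Ordinal.lt_omega0.1
      rw [← Ordinal.lt_mul_iff_div_lt hθ.ne', ← opow_add_one]
      exact h c
    choose n hn using h1
    have h2 := nsum_mod _ hθ ih ρ n hn
    refine h2.trans_lt ?_
    have h3 : nsum (fun d => ρ d % ω ^ ξ) < ω ^ ξ :=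
        ih _ fun d => Ordinal.mod_lt _ hθ.ne'
    calc _ < ω ^ ξ * ((∑ d, n d : ℕ) : Ordinal.{v}) + ω ^ ξ := by gcongr
      _ = ω ^ ξ * (((∑ d, n d) + 1 : ℕ) : Ordinal.{v}) := by
          push_cast; rw [mul_add_one]
      _ < ω ^ ξ * ω := by
          gcongr
          exact Ordinal.natCast_lt_omega0 _
      _ = _ := (opow_add_one _ _).symm
  | limit ξ hξ ih =>
    intro ρ h
    have h1 : ∀ c, ∃ η < ξ, ρ c < ω ^ η := fun c =>
      (Ordinal.lt_opow_of_isSuccLimit omega0_ne_zero hξ).1 (h c)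
    choose η hη hη' using h1
    have h2 : Finset.univ.sup η < ξ := by
      rw [Finset.sup_lt_iff hξ.bot_lt]
      exact fun c _ => hη c
    refine (ih _ h2 ρ fun c => (hη' c).trans_le ?_).trans_le ?_
    · exact opow_le_opow_right omega0_pos (Finset.le_sup (Finset.mem_univ c))
    · exact opow_le_opow_right omega0_pos h2.le

/-- Rank relation: `l` survives `α` derivations of `B` along nets from `N`. -/
def Rk {D V : Type*} (N : Set (D → V)) (B : Set (List V)) : Ordinal.{v} → List V → Prop :=
  WellFounded.fix (wellFounded_lt (α := Ordinal.{v})) fun α ih l =>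
    l ∈ B ∧ ∀ (β : Ordinal.{v}) (h : β < α), ∃ g ∈ N, ∀ u, ih β h (l ++ [g u])

lemma Rk_iff {D V : Type*} (N : Set (D → V)) (B : Set (List V)) (α : Ordinal.{v}) (l : List V) :
    Rk N B α l ↔ l ∈ B ∧ ∀ β < α, ∃ g ∈ N, ∀ u, Rk N B β (l ++ [g u]) := by
  conv_lhs => rw [Rk, WellFounded.fix_eq]
  rfl

lemma Rk.mem {D V : Type*} {N : Set (D → V)} {B : Set (List V)} {α : Ordinal.{v}} {l : List V}
    (h : Rk N B α l) : l ∈ B := ((Rk_iff N B α l).1 h).1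

lemma Rk.next {D V : Type*} {N : Set (D → V)} {B : Set (List V)} {α β : Ordinal.{v}} {l : List V}
    (h : Rk N B α l) (hβ : β < α) : ∃ g ∈ N, ∀ u, Rk N B β (l ++ [g u]) :=
  ((Rk_iff N B α l).1 h).2 β hβ

lemma Rk.mono {D V : Type*} {N : Set (D → V)} {B : Set (List V)} {α β : Ordinal.{v}} {l : List V}
    (h : Rk N B α l) (hβ : β ≤ α) : Rk N B β l :=
  (Rk_iff N B β l).2 ⟨h.mem, fun _ hγ => h.next (hγ.trans_le hβ)⟩

/-- Truncated rank. -/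
noncomputable def rkTr {D V : Type*} (N : Set (D → V)) (B : Set (List V)) (Ω : Ordinal.{v})
    (l : List V) : Ordinal.{v} := sSup {β | β ≤ Ω ∧ Rk N B β l}

lemma le_rkTr {D V : Type*} {N : Set (D → V)} {B : Set (List V)} {Ω β : Ordinal.{v}}
    {l : List V} (hβ : β ≤ Ω) (h : Rk N B β l) : β ≤ rkTr N B Ω l :=
  le_csSup ⟨Ω, fun _ hγ => hγ.1⟩ ⟨hβ, h⟩

lemma rkTr_spec {D V : Type*} {N : Set (D → V)} {B : Set (List V)} {Ω : Ordinal.{v}}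
    {l : List V} (hl : l ∈ B) : Rk N B (rkTr N B Ω l) l := by
  rw [Rk_iff]
  refine ⟨hl, fun β hβ => ?_⟩
  have hne : {β | β ≤ Ω ∧ Rk N B β l}.Nonempty :=
    ⟨0, zero_le, (Rk_iff _ _ _ _).2 ⟨hl, fun γ hγ => absurd hγ not_lt_zero⟩⟩
  obtain ⟨γ, hγ, hβγ⟩ := exists_lt_of_lt_csSup hne hβ
  exact hγ.2.next hβγ

/-- Members of a coloured list of a given colour. -/
def cls {V K : Type*} [DecidableEq K] (c : K) (cl : List (V × K)) : List V :=
  (cl.filter (fun z => z.2 = c)).map Prod.fst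

lemma cls_append {V K : Type*} [DecidableEq K] (c d : K) (cl : List (V × K)) (x : V) :
    cls c (cl ++ [(x, d)]) = if d = c then cls c cl ++ [x] else cls c cl := by
  unfold cls
  by_cases h : d = c <;> simp [h]

lemma finite_colorings {V K : Type*} [Finite K] (l : List V) :
    {cl : List (V × K) | cl.map Prod.fst = l}.Finite := by
  have : {cl : List (V × K) | cl.map Prod.fst = l}
      ⊆ (fun k : List K => l.zip k) '' {k : List K | k.length = l.length} := by
    rintro cl rfl
    refine ⟨cl.map Prod.snd, by simp, ?_⟩
    simpa [List.unzip_eq_map] using List.zip_unzip cl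
  exact (Set.Finite.image _ (List.finite_length_eq K l.length)).subset this

lemma dir_pigeonhole {D ι : Type*} [Nonempty D] {r : D → D → Prop} (hr : IsDirSys r)
    {S : Set ι} (hS : S.Finite) (k : D → ι) (hk : ∀ u, k u ∈ S) :
    ∃ c ∈ S, ∀ u, ∃ w, r u w ∧ k w = c := by
  by_contra hcon
  push Not at hcon
  choose! U hU using hcon
  have hub : ∀ s : Finset ι, ∃ u, ∀ c ∈ s, r (U c) u := by
    classical
    intro s
    induction s using Finset.induction_on with
    | empty => exact ⟨Classical.arbitrary D, by simp⟩
    | insert a s _ ih =>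
      obtain ⟨u, hu⟩ := ih
      obtain ⟨w, h1, h2⟩ := hr.2.2 (U a) u
      refine ⟨w, fun c hc => ?_⟩
      rcases Finset.mem_insert.1 hc with rfl | hc
      · exact h1
      · exact hr.2.1 _ _ _ (hu c hc) h2
  obtain ⟨u, hu⟩ := hub hS.toFinset
  exact hU (k u) (hk u) u (hu _ (by simpa using hk u)) rfl

lemma splitting {D V : Type*} {K : Type} [Fintype K] [DecidableEq K] [Nonempty D]
    {r : D → D → Prop} (hr : IsDirSys r) (N : Set (D → V))
    (hN : ∀ g ∈ N, ∀ w : D → D, (∀ u, r u (w u)) → g ∘ w ∈ N)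
    (B : Set (List V)) (Bc : K → Set (List V)) (hpre : ∀ c l x, l ++ [x] ∈ Bc c → l ∈ Bc c)
    (hbase : ∀ l ∈ B, ∃ cl : List (V × K), cl.map Prod.fst = l ∧ ∀ c, cls c cl ∈ Bc c)
    (Ω : Ordinal.{v}) (α : Ordinal.{v}) : α ≤ Ω → ∀ l, Rk N B α l →
      ∃ cl : List (V × K), cl.map Prod.fst = l ∧ (∀ c, cls c cl ∈ Bc c) ∧
        α ≤ nsum (fun c => rkTr N (Bc c) Ω (cls c cl)) := by
  induction α using WellFoundedLT.induction with
  | ind α ih =>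
  intro hα l hl
  -- for every `β < α` some colouring has sum `> β`
  have key : ∀ β < α, ∃ cl : List (V × K), cl.map Prod.fst = l ∧ (∀ c, cls c cl ∈ Bc c) ∧
        β < nsum (fun c => rkTr N (Bc c) Ω (cls c cl)) := by
    intro β hβ
    obtain ⟨g, hg, hgR⟩ := hl.next hβ
    have h1 : ∀ u, ∃ z : List (V × K) × K, z.1.map Prod.fst = l ∧
        (∀ c, cls c (z.1 ++ [(g u, z.2)]) ∈ Bc c) ∧
        β ≤ nsum (fun c => rkTr N (Bc c) Ω (cls c (z.1 ++ [(g u, z.2)]))) := by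
      intro u
      obtain ⟨cl, e, hv, hs⟩ := ih β hβ (hβ.le.trans hα) _ (hgR u)
      rcases List.eq_nil_or_concat cl with rfl | ⟨cl', ⟨x, k⟩, rfl⟩
      · simp at e
      · simp only [List.concat_eq_append, List.map_append, List.map_cons, List.map_nil] at e
        obtain ⟨e1, e2⟩ := List.append_inj' e rfl
        simp only [List.cons.injEq, and_true] at e2
        subst e2
        simp only [List.concat_eq_append] at hv hs
        exact ⟨(cl', k), e1, hv, hs⟩
    choose z hz1 hz2 hz3 using h1
    have hfin : ({cl : List (V × K) | cl.map Prod.fst = l} ×ˢ (Set.univ : Set K)).Finite :=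
      (finite_colorings l).prod Set.finite_univ
    obtain ⟨⟨cl, k⟩, hcl, hw⟩ := dir_pigeonhole hr hfin z (fun u => ⟨hz1 u, Set.mem_univ _⟩)
    choose w hrw hzw using hw
    have hv : ∀ u c, cls c (cl ++ [(g (w u), k)]) ∈ Bc c := by
      intro u; simpa [hzw] using hz2 (w u)
    have hs : ∀ u, β ≤ nsum (fun c => rkTr N (Bc c) Ω (cls c (cl ++ [(g (w u), k)]))) := by
      intro u; simpa [hzw] using hz3 (w u)
    have hvalid : ∀ c, cls c cl ∈ Bc c := by
      intro c
      have := hv (Classical.arbitrary D) c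
      rw [cls_append] at this
      split_ifs at this with h
      · exact hpre _ _ _ this
      · exact this
    refine ⟨cl, hcl.1, hvalid, ?_⟩
    set ρ : K → Ordinal.{v} := fun c => rkTr N (Bc c) Ω (cls c cl) with hρ
    have hupd : ∀ u, (fun c => rkTr N (Bc c) Ω (cls c (cl ++ [(g (w u), k)])))
        = Function.update ρ k (rkTr N (Bc k) Ω (cls k cl ++ [g (w u)])) := by
      intro u
      funext c
      rw [cls_append]
      by_cases h : k = c
      · subst h; simp
      · simp [h, Ne.symm h, hρ]
    let S : Set Ordinal.{v} := {b | β ≤ nsum (Function.update ρ k b)}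
    have hSβ : β ∈ S := le_nsum k β _ (by simp)
    have hmem : sInf S ∈ S := csInf_mem ⟨β, hSβ⟩
    have hlt : sInf S < Ω := (csInf_le' hSβ).trans_lt (hβ.trans_le hα)
    have hR : Rk N (Bc k) (Order.succ (sInf S)) (cls k cl) := by
      rw [Rk_iff]
      refine ⟨hvalid k, fun γ hγ => ⟨g ∘ w, hN g hg w hrw, fun u => ?_⟩⟩
      have hm : cls k cl ++ [g (w u)] ∈ Bc k := by
        have := hv u k
        rwa [cls_append, if_pos rfl] at this
      refine (rkTr_spec (Ω := Ω) hm).mono ((Order.lt_succ_iff.1 hγ).trans (csInf_le' ?_))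
      have := hs u
      rwa [hupd] at this
    have h2 : sInf S < ρ k :=
      (Order.lt_succ _).trans_le (le_rkTr (Order.succ_le_of_lt hlt) hR)
    exact lt_of_le_of_lt hmem (nsum_update_lt h2)
  -- choose the best colouring
  let Sv : Set (List (V × K)) := {cl | cl.map Prod.fst = l ∧ ∀ c, cls c cl ∈ Bc c}
  have hSv : Sv.Finite := (finite_colorings l).subset fun cl h => h.1
  have hSvne : Sv.Nonempty := hbase l hl.mem
  obtain ⟨cl, hcl, hmax⟩ := hSv.exists_maximalFor
    (fun cl => nsum (fun c => rkTr N (Bc c) Ω (cls c cl))) Sv hSvne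
  refine ⟨cl, hcl.1, hcl.2, ?_⟩
  by_contra hcon
  obtain ⟨cl', h1, h2, h3⟩ := key _ (not_le.1 hcon)
  exact absurd (hmax ⟨h1, h2⟩ h3.le) (not_le.2 h3)

lemma ramsey {D V : Type*} {K : Type} [Fintype K] [DecidableEq K] [Nonempty D]
    {r : D → D → Prop} (hr : IsDirSys r) (N : Set (D → V))
    (hN : ∀ g ∈ N, ∀ w : D → D, (∀ u, r u (w u)) → g ∘ w ∈ N)
    (B : Set (List V)) (Bc : K → Set (List V)) (hpre : ∀ c l x, l ++ [x] ∈ Bc c → l ∈ Bc c)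
    (hbase : ∀ l ∈ B, ∃ cl : List (V × K), cl.map Prod.fst = l ∧ ∀ c, cls c cl ∈ Bc c)
    (ξ : Ordinal.{v}) (h : Rk N B (ω ^ ξ) []) : ∃ c, Rk N (Bc c) (ω ^ ξ) [] := by
  obtain ⟨cl, e, hv, hs⟩ := splitting hr N hN B Bc hpre hbase (ω ^ ξ) (ω ^ ξ) le_rfl [] h
  obtain rfl : cl = [] := by simpa using e
  by_contra hcon
  push Not at hcon
  refine absurd hs (not_le.2 (nsum_lt_opow ξ _ fun c => ?_))
  by_contra hc
  exact hcon c ((rkTr_spec (hv c)).mono (not_lt.1 hc))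

lemma derivIter_zero {Λ : Type*} (T : Set (List Λ)) : derivIter T (0 : Ordinal.{v}) = T := by
  simp [derivIter]

lemma derivIter_add_one {Λ : Type*} (T : Set (List Λ)) (α : Ordinal.{v}) :
    derivIter T (α + 1) = derivIter T α \ maxNodes (derivIter T α) := by
  simp [derivIter]

lemma derivIter_limit {Λ : Type*} (T : Set (List Λ)) (α : Ordinal.{v}) (h : Order.IsSuccLimit α) :
    derivIter T α = ⋂ ζ : Set.Iio α, derivIter T ζ.1 := by
  conv_lhs => rw [derivIter, limitRecOn_limit _ _ _ _ h]
  rfl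

lemma derivIter_anti {Λ : Type*} (T : Set (List Λ)) (α : Ordinal.{v}) :
    ∀ β ≤ α, derivIter T α ⊆ derivIter T β := by
  induction α using Ordinal.limitRecOn with
  | zero => intro β hβ; rw [nonpos_iff_eq_zero.1 hβ]
  | add_one α ih =>
    intro β hβ
    rcases hβ.eq_or_lt with rfl | h
    · rfl
    · rw [derivIter_add_one]
      exact Set.sdiff_subset.trans (ih β (Order.lt_add_one_iff.1 h))
  | limit α hα ih =>
    intro β hβ
    rcases hβ.eq_or_lt with rfl | h
    · rfl
    · rw [derivIter_limit T α hα]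
      exact Set.iInter_subset (fun ζ : Set.Iio α => derivIter T ζ.1) ⟨β, h⟩

lemma derivIter_prefix {Λ : Type*} {T : Set (List Λ)} (hT : IsTree T) (α : Ordinal.{v}) :
    ∀ s t : List Λ, t ∈ derivIter T α → s <+: t → s ≠ [] → s ∈ derivIter T α := by
  induction α using Ordinal.limitRecOn with
  | zero => rw [derivIter_zero]; exact hT.2
  | add_one α ih =>
    intro s t ht hst hs
    rw [derivIter_add_one] at ht ⊢
    refine ⟨ih s t ht.1 hst hs, fun hmax => ?_⟩
    have := hmax.2 t ht.1 hst
    subst this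
    exact ht.2 hmax
  | limit α hα ih =>
    intro s t ht hst hs
    rw [derivIter_limit T α hα] at ht ⊢
    simp only [Set.mem_iInter] at ht ⊢
    exact fun ζ => ih ζ.1 ζ.2 s t (ht ζ) hst hs

lemma mem_derivIter_add_one {Λ : Type*} {T : Set (List Λ)} (hT : IsTree T) (α : Ordinal.{v})
    (t : List Λ) (ht : t ≠ []) :
    t ∈ derivIter T (α + 1) ↔ ∃ ζ, t ++ [ζ] ∈ derivIter T α := by
  rw [derivIter_add_one]
  constructor
  · rintro ⟨h1, h2⟩
    simp only [maxNodes, Set.mem_ofPred_eq, not_and, not_forall] at h2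
    obtain ⟨s, hs, ⟨q, rfl⟩, hne⟩ := h2 h1
    cases q with
    | nil => simp at hne
    | cons ζ q =>
      exact ⟨ζ, derivIter_prefix hT α _ _ hs ⟨q, by simp⟩ (by simp)⟩
  · rintro ⟨ζ, h⟩
    refine ⟨derivIter_prefix hT α _ _ h ⟨[ζ], rfl⟩ ht, fun hmax => ?_⟩
    have := hmax.2 _ h ⟨[ζ], rfl⟩
    simp at this

/-- Rank function on a tree of rank `Ω`. -/
lemma exists_rank {Λ : Type*} {T : Set (List Λ)} (hT : IsTree T) (Ω : Ordinal.{v})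
    (hΩ : derivIter T Ω = ∅) :
    ∃ ρ : List Λ → Ordinal.{v}, (∀ t ∈ T, ρ t < Ω) ∧
      ∀ t ζ, t ≠ [] → t ++ [ζ] ∈ T → ρ (t ++ [ζ]) < ρ t := by
  have h1 : ∀ t ∈ T, ∃ b < Ω, t ∈ derivIter T b ∧ t ∉ derivIter T (b + 1) := by
    intro t ht
    by_contra hcon
    push Not at hcon
    have : ∀ a : Ordinal.{v}, a ≤ Ω → t ∈ derivIter T a := by
      intro a
      induction a using Ordinal.limitRecOn with
      | zero => intro _; rwa [derivIter_zero]
      | add_one a ih =>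
        intro ha
        have ha' : a < Ω := Order.add_one_le_iff.1 ha
        exact hcon a ha' (ih ha'.le)
      | limit a hlim ih =>
        intro ha
        rw [derivIter_limit T a hlim, Set.mem_iInter]
        exact fun ζ => ih ζ.1 ζ.2 (ζ.2.le.trans ha)
    have := this Ω le_rfl
    rw [hΩ] at this
    exact this
  choose! ρ h2 h3 h4 using h1
  refine ⟨ρ, h2, fun t ζ ht htζ => ?_⟩
  have htT : t ∈ T := hT.2 _ _ htζ ⟨[ζ], rfl⟩ ht
  by_contra hcon
  apply h4 t htT
  have h5 : t ∈ derivIter T (ρ (t ++ [ζ]) + 1) :=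
    (mem_derivIter_add_one hT _ t ht).2 ⟨ζ, h3 _ htζ⟩
  exact derivIter_anti T _ _ (by gcongr; exact not_lt.1 hcon) h5

lemma treeRank_spec {Λ : Type*} {T : Set (List Λ)} {Ω : Ordinal.{v}} (h : treeRank T = Ω)
    (h0 : 0 < Ω) : derivIter T Ω = ∅ ∧ ∀ β < Ω, (derivIter T β).Nonempty := by
  have hne : {ξ : Ordinal.{v} | derivIter T ξ = ∅}.Nonempty := by
    by_contra hcon
    rw [Set.not_nonempty_iff_eq_empty] at hcon
    rw [treeRank, hcon, Ordinal.sInf_empty] at h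
    exact h0.ne h
  constructor
  · rw [← h]; exact csInf_mem hne
  · intro β hβ
    rw [Set.nonempty_iff_ne_empty]
    intro he
    rw [← h] at hβ
    have hm : β ∈ {ξ : Ordinal.{v} | derivIter T ξ = ∅} := he
    exact absurd (csInf_le' hm) (not_le.2 hβ)

/-- The collection along `T.D` produces rank. -/
lemma Rk_of_tree {Λ D V : Type*} {T : Set (List Λ)} (hT : IsTree T)
    (N : Set (D → V)) (B : Set (List V)) (x : List (Λ × D) → V)
    (hx : ∀ t ζ, (∀ u : D, t ++ [(ζ, u)] ∈ TD T D) → (fun u => x (t ++ [(ζ, u)])) ∈ N)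
    (hB : ∀ t ∈ TD T D, ∀ l : List V, (∀ z ∈ l, z ∈ branchSet x t) → l ∈ B)
    (hB0 : [] ∈ B) (Ω : Ordinal.{v}) (hΩ : ∀ β < Ω, (derivIter T β).Nonempty) :
    Rk N B Ω [] := by
  have hsub : ∀ α : Ordinal.{v}, derivIter T α ⊆ T := fun α => by
    simpa [derivIter_zero] using derivIter_anti T α 0 zero_le
  have main : ∀ α : Ordinal.{v}, ∀ t : List (Λ × D), t.map Prod.fst ∈ derivIter T α →
      ∀ l : List V, (∀ z ∈ l, z ∈ branchSet x t) → Rk N B α l := by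
    intro α
    induction α using WellFoundedLT.induction with
    | ind α ih =>
    intro t ht l hl
    rw [Rk_iff]
    refine ⟨hB t (hsub _ ht) l hl, fun β hβ => ?_⟩
    have htne : t.map Prod.fst ≠ [] := fun h => hT.1 (h ▸ hsub _ ht)
    obtain ⟨ζ, hζ⟩ := (mem_derivIter_add_one hT β _ htne).1
      (derivIter_anti T α (β + 1) (Order.add_one_le_iff.2 hβ) ht)
    have hζ' : ∀ u : D, (t ++ [(ζ, u)]).map Prod.fst ∈ derivIter T β := by
      intro u; simpa using hζ
    refine ⟨_, hx t ζ fun u => hsub _ (hζ' u), fun u => ?_⟩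
    refine ih β hβ _ (hζ' u) _ fun z hz => ?_
    rcases List.mem_append.1 hz with hz | hz
    · obtain ⟨s, h1, h2, h3⟩ := hl z hz
      exact ⟨s, h1, h2.trans ⟨_, rfl⟩, h3⟩
    · rw [List.mem_singleton] at hz
      exact ⟨_, by simp, List.prefix_rfl, hz⟩
  rw [Rk_iff]
  refine ⟨hB0, fun β hβ => ?_⟩
  obtain ⟨t, ht⟩ := hΩ β hβ
  have htne : t ≠ [] := fun h => hT.1 (h ▸ hsub _ ht)
  obtain ⟨ζ, q, rfl⟩ := List.exists_cons_of_ne_nil htne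
  have hζ : [ζ] ∈ derivIter T β := derivIter_prefix hT β _ _ ht ⟨q, by simp⟩ (by simp)
  have hζ' : ∀ u : D, ([] ++ [(ζ, u)]).map Prod.fst ∈ derivIter T β := by
    intro u; simpa using hζ
  refine ⟨_, hx [] ζ fun u => hsub _ (hζ' u), fun u => ?_⟩
  refine main β _ (hζ' u) _ fun z hz => ?_
  have hz : z = x ([] ++ [(ζ, u)]) := by simpa using hz
  exact ⟨_, by simp, List.prefix_rfl, hz⟩

/-- Rank produces a collection along `T.D`. -/
lemma tree_of_Rk {Λ D V : Type*} [Nonempty D] [Nonempty V] {T : Set (List Λ)} (hT : IsTree T)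
    (N : Set (D → V)) (B : Set (List V)) (Ω : Ordinal.{v}) (hΩ : derivIter T Ω = ∅)
    (hR : Rk N B Ω []) :
    ∃ x : List (Λ × D) → V,
      (∀ t ζ, (∀ u : D, t ++ [(ζ, u)] ∈ TD T D) → (fun u => x (t ++ [(ζ, u)])) ∈ N) ∧
      ∀ t ∈ TD T D, ∃ l ∈ B, ∀ z ∈ branchSet x t, z ∈ l := by
  classical
  obtain ⟨ρ, hρ1, hρ2⟩ := exists_rank hT Ω hΩ
  have hG : ∀ (l : List V) (b : Ordinal.{v}), ∃ g : D → V,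
      (∃ g ∈ N, ∀ u, Rk N B b (l ++ [g u])) → g ∈ N ∧ ∀ u, Rk N B b (l ++ [g u]) := by
    intro l b
    by_cases h : ∃ g ∈ N, ∀ u, Rk N B b (l ++ [g u])
    · obtain ⟨g, hg⟩ := h
      exact ⟨g, fun _ => hg⟩
    · exact ⟨fun _ => Classical.arbitrary V, fun h' => absurd h' h⟩
  choose G hG using hG
  let step : List Λ × List V → Λ × D → List Λ × List V := fun a z =>
    (a.1 ++ [z.1], a.2 ++ [G a.2 (ρ (a.1 ++ [z.1])) z.2])
  let H : List (Λ × D) → List Λ × List V := fun t => t.foldl step ([], [])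
  have H1 : ∀ t, (H t).1 = t.map Prod.fst := by
    intro t
    induction t using List.reverseRecOn with
    | nil => rfl
    | append_singleton t z ih =>
      simp only [H, List.foldl_append, List.foldl_cons, List.foldl_nil, step] at ih ⊢
      simp [ih]
  have H2 : ∀ t ζ u, (H (t ++ [(ζ, u)])).2
      = (H t).2 ++ [G (H t).2 (ρ (t.map Prod.fst ++ [ζ])) u] := by
    intro t ζ u
    rw [← H1 t]
    simp only [H, List.foldl_append, List.foldl_cons, List.foldl_nil, step]
  let x : List (Λ × D) → V := fun t => (H t).2.getLastD (Classical.arbitrary V)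
  have hx : ∀ t ζ u, x (t ++ [(ζ, u)]) = G (H t).2 (ρ (t.map Prod.fst ++ [ζ])) u := by
    intro t ζ u
    simp [x, H2]
  have hex : ∀ t ζ, t.map Prod.fst ++ [ζ] ∈ T →
      (t ∈ TD T D → Rk N B (ρ (t.map Prod.fst)) (H t).2) →
      ∃ g ∈ N, ∀ u, Rk N B (ρ (t.map Prod.fst ++ [ζ])) ((H t).2 ++ [g u]) := by
    intro t ζ htζ hind
    by_cases ht : t = []
    · subst ht
      exact hR.next (hρ1 _ htζ)
    · have ht' : t.map Prod.fst ≠ [] := by simpa using ht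
      have : t ∈ TD T D := hT.2 _ _ htζ ⟨[ζ], rfl⟩ ht'
      exact (hind this).next (hρ2 _ _ ht' htζ)
  have main : ∀ t, t ∈ TD T D → Rk N B (ρ (t.map Prod.fst)) (H t).2 := by
    intro t
    induction t using List.reverseRecOn with
    | nil => intro h; exact absurd h hT.1
    | append_singleton t z ih =>
      intro h
      obtain ⟨ζ, u⟩ := z
      have h' : t.map Prod.fst ++ [ζ] ∈ T := by simpa [TD] using h
      rw [H2]
      simpa using (hG _ _ (hex t ζ h' ih)).2 u
  refine ⟨x, fun t ζ h => ?_, fun t ht => ⟨(H t).2, (main t ht).mem, ?_⟩⟩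
  · have h' : t.map Prod.fst ++ [ζ] ∈ T := by simpa [TD] using h (Classical.arbitrary D)
    simp only [hx]
    exact (hG _ _ (hex t ζ h' (main t))).1
  · clear ht
    induction t using List.reverseRecOn with
    | nil =>
      rintro z ⟨s, hs, hs', rfl⟩
      exact absurd (List.prefix_nil.1 hs') hs
    | append_singleton t z ih =>
      obtain ⟨ζ, u⟩ := z
      rintro v ⟨s, hs, hs', rfl⟩
      rw [H2]
      rcases List.prefix_concat_iff.1 hs' with rfl | h
      · rw [hx]; simp
      · exact List.mem_append_left _ (ih _ ⟨s, hs, h, rfl⟩)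

lemma minkowski_two {p : ℝ} (hp : 1 < p) {a s d : ℝ} (ha : 0 ≤ a) (hs : 0 ≤ s) (hd : 0 ≤ d) :
    (a ^ p + (s + d) ^ p) ^ (1 / p) ≤ (a ^ p + s ^ p) ^ (1 / p) + d := by
  have h := Real.Lp_add_le_of_nonneg (Finset.univ : Finset (Fin 2)) (f := ![a, s]) (g := ![0, d])
    hp.le (by intro i _; fin_cases i <;> simpa) (by intro i _; fin_cases i <;> simpa)
  have hp0 : p ≠ 0 := by linarith
  simp only [Fin.sum_univ_two, Matrix.cons_val_zero, Matrix.cons_val_one, add_zero,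
    Real.zero_rpow hp0, zero_add] at h
  rwa [← Real.rpow_mul hd, mul_one_div_cancel hp0, Real.rpow_one] at h

lemma exists_almost_norming {E : Type*} [NormedAddCommGroup E] [NormedSpace ℝ E] (g : E →L[ℝ] ℝ)
    {m ε : ℝ} (hm : 0 ≤ m) (hε : 0 < ε) : ∃ w : E, ‖w‖ ≤ m ∧ ‖g‖ * m - ε ≤ g w := by
  rcases hm.eq_or_lt with rfl | hm
  · exact ⟨0, by simp, by simp [hε.le]⟩
  obtain ⟨z, hz, hz'⟩ := g.exists_lt_apply_of_lt_opNorm (r := ‖g‖ - ε / m)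
    (sub_lt_self _ (by positivity))
  have key : ‖g‖ * m - ε ≤ m * |g z| := by
    have h1 := mul_le_mul_of_nonneg_left hz'.le hm.le
    rw [Real.norm_eq_abs] at h1
    have h2 : m * (‖g‖ - ε / m) = ‖g‖ * m - ε := by field_simp
    linarith
  rcases le_total 0 (g z) with h | h
  · refine ⟨m • z, ?_, ?_⟩
    · rw [norm_smul, Real.norm_of_nonneg hm.le]; nlinarith
    · rw [abs_of_nonneg h] at key; simpa using key
  · refine ⟨-(m • z), ?_, ?_⟩
    · rw [norm_neg, norm_smul, Real.norm_of_nonneg hm.le]; nlinarith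
    · rw [abs_of_nonpos h] at key; simpa using key

lemma exists_functional {E : Type*} [NormedAddCommGroup E] [NormedSpace ℝ E] {s : Set E}
    (hs : Convex ℝ s) {b : ℝ} (hb : 0 < b) (h : ∀ z ∈ s, b ≤ ‖z‖) :
    ∃ f : E →L[ℝ] ℝ, ‖f‖ ≤ 1 ∧ ∀ z ∈ s, b ≤ f z := by
  obtain ⟨f, u, h1, h2⟩ := geometric_hahn_banach_open (convex_ball (0 : E) b) Metric.isOpen_ball hs
    (Set.disjoint_left.2 fun z hz hz' => by
      have := h z hz'
      rw [mem_ball_zero_iff] at hz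
      linarith)
  have hu : 0 < u := by simpa using h1 0 (by simpa using hb)
  have hf : ‖f‖ ≤ u / b := by
    by_contra hcon
    obtain ⟨z, hz, hz'⟩ := f.exists_lt_apply_of_lt_opNorm (not_le.1 hcon)
    rw [div_lt_iff₀ hb, Real.norm_eq_abs] at hz'
    have hbz : ‖b • z‖ < b := by
      rw [norm_smul, Real.norm_of_nonneg hb.le]; nlinarith
    have h3 := h1 (b • z) (by simpa using hbz)
    have h4 := h1 (-(b • z)) (by simpa using hbz)
    simp only [map_neg, map_smul, _root_.smul_eq_mul] at h3 h4
    rcases abs_cases (f z) with ⟨e, _⟩ | ⟨e, _⟩ <;> rw [e] at hz' <;> nlinarith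
  refine ⟨(b / u) • f, ?_, fun z hz => ?_⟩
  · rw [norm_smul, Real.norm_of_nonneg (by positivity)]
    calc b / u * ‖f‖ ≤ b / u * (u / b) := by gcongr
      _ = 1 := by field_simp
  · have := h2 z hz
    simp only [_root_.smul_apply, _root_.smul_eq_mul]
    calc b = b / u * u := by field_simp
      _ ≤ _ := by gcongr

lemma netFilter_reindex {D : Type*} {r : D → D → Prop} (hr : IsDirSys r) (w : D → D)
    (hw : ∀ u, r u (w u)) : Tendsto w (netFilter r) (netFilter r) := by
  unfold netFilter
  refine tendsto_iInf.2 fun a => tendsto_principal.2 ?_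
  refine mem_iInf_of_mem a (mem_principal.2 fun u hu => ?_)
  exact hr.2.1 _ _ _ hu (hw u)

lemma functional_bound {I : Type} [DecidableEq I] (p : ℝ) (hp : 1 < p)
    [Fact (1 ≤ ENNReal.ofReal p)]
    {X Y : I → Type*} [∀ i, NormedAddCommGroup (X i)] [∀ i, NormedSpace ℝ (X i)]
    [∀ i, NormedAddCommGroup (Y i)] [∀ i, NormedSpace ℝ (Y i)]
    (A : ∀ i, X i →L[ℝ] Y i)
    (Aop : lp X (ENNReal.ofReal p) →L[ℝ] lp Y (ENNReal.ofReal p))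
    (hAop : ∀ (x : lp X (ENNReal.ofReal p)) (i : I),
      (Aop x : ∀ i, Y i) i = A i ((x : ∀ i, X i) i))
    (C : ℝ) (hC : 0 < C) (hAC : ∀ i, ‖A i‖ ≤ C)
    (y : lp Y (ENNReal.ofReal p)) (x : lp X (ENNReal.ofReal p)) (F : Finset I) (ε η : ℝ)
    (hε : 0 < ε) (hη : ‖y - ∑ i ∈ F, lp.single (ENNReal.ofReal p) i (y i)‖ ≤ η)
    (f : lp Y (ENNReal.ofReal p) →L[ℝ] ℝ) (hf : ‖f‖ ≤ 1)
    (h : ∀ i ∈ F, (f.comp (lp.singleContinuousLinearMap ℝ Y (ENNReal.ofReal p) i))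
        (y i + A i (x i)) ≤
      ‖f.comp (lp.singleContinuousLinearMap ℝ Y (ENNReal.ofReal p) i)‖ *
        (‖y i‖ ^ p + (C * ‖x i‖) ^ p) ^ (1 / p) + ε) :
    f (y + Aop x) ≤ (‖y‖ ^ p + C ^ p * ‖x‖ ^ p) ^ (1 / p) + F.card * (2 * ε) + η := by
  have hp0 : 0 < p := by linarith
  have hpt : (ENNReal.ofReal p).toReal = p := ENNReal.toReal_ofReal hp0.le
  have hpt0 : 0 < (ENNReal.ofReal p).toReal := by rw [hpt]; exact hp0
  have hw : ∀ i, ∃ w : Y i, ‖w‖ ≤ (‖y i‖ ^ p + (C * ‖x i‖) ^ p) ^ (1 / p) ∧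
      ‖f.comp (lp.singleContinuousLinearMap ℝ Y (ENNReal.ofReal p) i)‖ *
        (‖y i‖ ^ p + (C * ‖x i‖) ^ p) ^ (1 / p) - ε ≤
      (f.comp (lp.singleContinuousLinearMap ℝ Y (ENNReal.ofReal p) i)) w := fun i =>
    exists_almost_norming _ (by positivity) hε
  choose w hw1 hw2 using hw
  set W : lp Y (ENNReal.ofReal p) :=
    Aop x + ∑ i ∈ F, lp.single (ENNReal.ofReal p) i (w i - A i (x i)) with hW
  have hWi : ∀ i, W i = if i ∈ F then w i else A i (x i) := by
    intro i
    rw [hW, lp.coeFn_add, Pi.add_apply, hAop, lp.coeFn_sum, Finset.sum_apply]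
    simp only [lp.coeFn_single, Finset.sum_pi_single]
    split_ifs <;> simp
  have hWb : ∀ i, ‖W i‖ ^ p ≤ ‖y i‖ ^ p + C ^ p * ‖x i‖ ^ p := by
    intro i
    rw [hWi]
    split_ifs
    · have := Real.rpow_le_rpow (norm_nonneg _) (hw1 i) hp0.le
      rwa [← Real.rpow_mul (by positivity), one_div_mul_cancel hp0.ne', Real.rpow_one,
        Real.mul_rpow hC.le (norm_nonneg _)] at this
    · have h1 : ‖A i (x i)‖ ≤ C * ‖x i‖ := (A i).le_of_opNorm_le (hAC i) _
      have h2 := Real.rpow_le_rpow (norm_nonneg _) h1 hp0.le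
      rw [Real.mul_rpow hC.le (norm_nonneg _)] at h2
      have : 0 ≤ ‖y i‖ ^ p := by positivity
      linarith
  have hWn : ‖W‖ ≤ (‖y‖ ^ p + C ^ p * ‖x‖ ^ p) ^ (1 / p) := by
    refine lp.norm_le_of_tsum_le hpt0 (by positivity) ?_
    have sW := (lp.memℓp W).summable hpt0
    have sy := (lp.memℓp y).summable hpt0
    have sx := (lp.memℓp x).summable hpt0
    have ny := lp.norm_rpow_eq_tsum hpt0 y
    have nx := lp.norm_rpow_eq_tsum hpt0 x
    rw [hpt] at sW sy sx ny nx ⊢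
    rw [← Real.rpow_mul (by positivity), one_div_mul_cancel hp0.ne', Real.rpow_one, ny, nx,
      ← tsum_mul_left, ← sy.tsum_add (sx.mul_left _)]
    exact sW.tsum_le_tsum hWb (sy.add (sx.mul_left _))
  have hdec : y + Aop x = W + ∑ i ∈ F, lp.single (ENNReal.ofReal p) i (y i + A i (x i) - w i)
      + (y - ∑ i ∈ F, lp.single (ENNReal.ofReal p) i (y i)) := by
    rw [hW]
    simp only [lp.single_sub, lp.single_add, Finset.sum_sub_distrib, Finset.sum_add_distrib]
    abel
  have hfn : ∀ z, f z ≤ ‖z‖ := fun z =>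
    (le_abs_self _).trans (by simpa using f.le_of_opNorm_le hf z)
  rw [hdec, map_add, map_add, map_sum]
  have hsum : ∑ i ∈ F, f (lp.single (ENNReal.ofReal p) i (y i + A i (x i) - w i))
      ≤ F.card * (2 * ε) := by
    rw [← _root_.nsmul_eq_mul]
    refine Finset.sum_le_card_nsmul _ _ _ fun i hi => ?_
    have h1 := h i hi
    have h2 := hw2 i
    simp only [ContinuousLinearMap.comp_apply, lp.singleContinuousLinearMap_apply] at h1 h2
    rw [lp.single_sub, map_sub]
    linarith
  have := hfn W
  have := hfn (y - ∑ i ∈ F, lp.single (ENNReal.ofReal p) i (y i))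
  linarith

lemma tAdmissible_directSum {I : Type} (ξ : Ordinal.{v}) (p : ℝ) (hp : 1 < p)
    [Fact (1 ≤ ENNReal.ofReal p)]
    {X Y : I → Type*} [∀ i, NormedAddCommGroup (X i)] [∀ i, NormedSpace ℝ (X i)]
    [∀ i, NormedAddCommGroup (Y i)] [∀ i, NormedSpace ℝ (Y i)]
    (A : ∀ i, X i →L[ℝ] Y i)
    (Aop : lp X (ENNReal.ofReal p) →L[ℝ] lp Y (ENNReal.ofReal p))
    (hAop : ∀ (x : lp X (ENNReal.ofReal p)) (i : I),
      (Aop x : ∀ i, Y i) i = A i ((x : ∀ i, X i) i))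
    (C : ℝ) (hC : 0 < C) (hAC : ∀ i, ‖A i‖ ≤ C) (hadm : ∀ i, tAdmissible ξ p (A i) C) :
    tAdmissible ξ p Aop C := by
  classical
  intro σ hσ y Λ D r T x hD hr hT hrank hxσ hxN
  have hp0 : 0 < p := by linarith
  have hq0 : 0 < ENNReal.ofReal p := ENNReal.ofReal_pos.2 hp0
  set S : Set ℝ := {c : ℝ | ∃ t ∈ TD T D, ∃ v ∈ convexHull ℝ (branchSet x t),
    c = ‖y + Aop v‖ ^ p} with hS
  by_contra hcon
  rw [not_le] at hcon
  have hBp : 0 ≤ ‖y‖ ^ p + C ^ p * σ ^ p := by positivity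
  have hSpos : 0 < sInf S := hBp.trans_lt hcon
  set b : ℝ := (sInf S) ^ (1 / p) with hb
  have hb0 : 0 < b := by positivity
  set β : ℝ := (‖y‖ ^ p + C ^ p * σ ^ p) ^ (1 / p) with hβ
  have hgap : β < b := Real.rpow_lt_rpow hBp hcon (by positivity)
  have hbranch : ∀ t ∈ TD T D, ∀ v ∈ convexHull ℝ (branchSet x t), b ≤ ‖y + Aop v‖ := by
    intro t ht v hv
    have h1 : sInf S ≤ ‖y + Aop v‖ ^ p := csInf_le
      ⟨0, by rintro c ⟨t, _, v, _, rfl⟩; positivity⟩ ⟨t, ht, v, hv, rfl⟩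
    have h2 := Real.rpow_le_rpow hSpos.le h1 (by positivity : 0 ≤ 1 / p)
    rwa [← Real.rpow_mul (norm_nonneg _), mul_one_div_cancel hp0.ne', Real.rpow_one] at h2
  -- parameters
  obtain ⟨F, hF⟩ : ∃ F : Finset I,
      ‖y - ∑ i ∈ F, lp.single (ENNReal.ofReal p) i (y i)‖ ≤ (b - β) / 4 := by
    have h1 := lp.hasSum_single (ENNReal.ofReal_ne_top (r := p)) y
    obtain ⟨F, hF⟩ := ((Metric.tendsto_nhds.1 h1 ((b - β) / 4) (by linarith))).exists
    exact ⟨F, by rw [dist_comm, dist_eq_norm] at hF; exact hF.le⟩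
  obtain ⟨ε, hε, hεF⟩ : ∃ ε : ℝ, 0 < ε ∧ F.card * (2 * ε) ≤ (b - β) / 4 := by
    refine ⟨(b - β) / 4 / (2 * (F.card + 1)), ?_, ?_⟩
    · have : 0 < b - β := by linarith
      positivity
    · have : 0 < b - β := by linarith
      have h1 : (F.card : ℝ) * (2 * ((b - β) / 4 / (2 * (F.card + 1))))
          = (b - β) / 4 * (F.card / (F.card + 1)) := by field_simp
      rw [h1]
      refine mul_le_of_le_one_right (by positivity) ?_
      rw [div_le_one (by positivity)]
      linarith
  obtain ⟨δ, hδ, hCδ⟩ : ∃ δ : ℝ, 0 < δ ∧ C * δ < ε :=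
    ⟨ε / (2 * C), by positivity, by
      have : C * (ε / (2 * C)) = ε / 2 := by field_simp
      linarith⟩
  obtain ⟨n, hn⟩ := exists_nat_gt (σ / δ)
  let m : I → ℝ → ℝ := fun i s => (‖y i‖ ^ p + (C * s) ^ p) ^ (1 / p)
  have hm0 : ∀ i s, 0 ≤ s → 0 ≤ m i s := fun i s hs => by positivity
  have hmmono : ∀ i s s', 0 ≤ s → s ≤ s' → m i s ≤ m i s' := by
    intro i s s' hs hss'
    have : 0 ≤ s' := hs.trans hss'
    simp only [m]
    gcongr
  let N : Set (D → lp X (ENNReal.ofReal p)) :=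
    {g | ∀ f : lp X (ENNReal.ofReal p) →L[ℝ] ℝ, Tendsto (fun u => f (g u)) (netFilter r) (nhds 0)}
  have hN : ∀ g ∈ N, ∀ w : D → D, (∀ u, r u (w u)) → g ∘ w ∈ N := by
    intro g hg w hw f
    exact (hg f).comp (netFilter_reindex hr w hw)
  let B : Set (List (lp X (ENNReal.ofReal p))) :=
    {l | (∀ z ∈ l, ‖z‖ ≤ σ) ∧ ∃ f : lp Y (ENNReal.ofReal p) →L[ℝ] ℝ, ‖f‖ ≤ 1 ∧
      ∀ z ∈ l, b ≤ f (y + Aop z)}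
  let Bc : F × Fin n → Set (List (lp X (ENNReal.ofReal p))) := fun c =>
    {l | (∀ z ∈ l, ‖z c.1.1‖ ≤ ((c.2 : ℕ) + 1) * δ) ∧
      ∀ v ∈ convexHull ℝ {z | z ∈ l},
        m c.1.1 ((c.2 : ℕ) * δ) + ε ≤ ‖y c.1.1 + A c.1.1 (v c.1.1)‖}
  have hpre : ∀ c l z, l ++ [z] ∈ Bc c → l ∈ Bc c := by
    intro c l z h
    refine ⟨fun w hw => h.1 w (List.mem_append_left _ hw), fun v hv => h.2 v ?_⟩
    exact convexHull_mono (fun w hw => List.mem_append_left _ hw) hv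
  have hbase : ∀ l ∈ B, ∃ cl : List (lp X (ENNReal.ofReal p) × (F × Fin n)),
      cl.map Prod.fst = l ∧ ∀ c, cls c cl ∈ Bc c := by
    rintro l ⟨hlσ, f, hf, hfl⟩
    let fi : ∀ i, Y i →L[ℝ] ℝ := fun i =>
      f.comp (lp.singleContinuousLinearMap ℝ Y (ENNReal.ofReal p) i)
    have hfi : ∀ i, ‖fi i‖ ≤ 1 := by
      intro i
      refine ContinuousLinearMap.opNorm_le_bound _ zero_le_one fun z => ?_
      have h1 := f.le_of_opNorm_le hf (lp.single (ENNReal.ofReal p) i z)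
      rw [lp.norm_single hq0] at h1
      exact h1
    have hviol : ∀ z ∈ l, ∃ c : F × Fin n, ((c.2 : ℕ) : ℝ) * δ ≤ ‖z c.1.1‖ ∧
        ‖z c.1.1‖ ≤ ((c.2 : ℕ) + 1) * δ ∧
        ‖fi c.1.1‖ * m c.1.1 ‖z c.1.1‖ + ε < fi c.1.1 (y c.1.1 + A c.1.1 (z c.1.1)) := by
      intro z hz
      have h1 : ∃ i ∈ F, ‖fi i‖ * m i ‖z i‖ + ε < fi i (y i + A i (z i)) := by
        by_contra hno
        push Not at hno
        have h2 := functional_bound p hp A Aop hAop C hC hAC y z F ε _ hε hF f hf hno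
        have h3 : (‖y‖ ^ p + C ^ p * ‖z‖ ^ p) ^ (1 / p) ≤ β := by
          rw [hβ]
          have := hlσ z hz
          gcongr
        have h4 := hfl z hz
        linarith
      obtain ⟨i, hi, hlt⟩ := h1
      have hzi : ‖z i‖ ≤ σ := (lp.norm_apply_le_norm hq0.ne' z i).trans (hlσ z hz)
      have h0 : 0 ≤ ‖z i‖ / δ := by positivity
      have hfl : ⌊‖z i‖ / δ⌋₊ < n := by
        rw [Nat.floor_lt h0]
        exact (div_le_div_of_nonneg_right hzi hδ.le).trans_lt hn
      refine ⟨(⟨i, hi⟩, ⟨⌊‖z i‖ / δ⌋₊, hfl⟩), ?_, ?_, hlt⟩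
      · exact (le_div_iff₀ hδ).1 (Nat.floor_le h0)
      · exact (div_le_iff₀ hδ).1 (Nat.lt_floor_add_one _).le
    rcases isEmpty_or_nonempty (F × Fin n) with hemp | hne
    · have : l = [] := by
        rw [List.eq_nil_iff_forall_not_mem]
        intro z hz
        obtain ⟨c, _⟩ := hviol z hz
        exact hemp.elim c
      exact ⟨[], by simp [this], fun c => hemp.elim c⟩
    choose! κ hκ1 hκ2 hκ3 using hviol
    refine ⟨l.map fun z => (z, κ z), by simp [Function.comp_def], fun c => ?_⟩
    have hmem : ∀ z ∈ cls c (l.map fun z => (z, κ z)), z ∈ l ∧ κ z = c := by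
      intro z hz
      simp only [cls, List.mem_map, List.mem_filter] at hz
      obtain ⟨_, ⟨⟨z', hz', rfl⟩, h2⟩, rfl⟩ := hz
      exact ⟨hz', by simpa using h2⟩
    refine ⟨fun z hz => ?_, fun v hv => ?_⟩
    · obtain ⟨h1, rfl⟩ := hmem z hz
      exact hκ2 z h1
    · obtain ⟨⟨i, hi⟩, k⟩ := c
      simp only
      let φ : lp X (ENNReal.ofReal p) →L[ℝ] ℝ :=
        (fi i).comp ((A i).comp (lp.evalCLM ℝ X (ENNReal.ofReal p) i))
      have hφ : ∀ z : lp X (ENNReal.ofReal p), fi i (y i + A i (z i)) = fi i (y i) + φ z := by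
        intro z
        rw [map_add]
        rfl
      have hsub : {z | z ∈ cls ((⟨i, hi⟩, k) : F × Fin n) (l.map fun z => (z, κ z))} ⊆
          {z | ‖fi i‖ * m i ((k : ℕ) * δ) + ε - fi i (y i) < φ z} := by
        intro z hz
        obtain ⟨h1, h2⟩ := hmem z hz
        have g1 := hκ1 z h1
        have g3 := hκ3 z h1
        rw [h2] at g1 g3
        simp only at g1 g3
        rw [hφ] at g3
        have g4 := hmmono i ((k : ℕ) * δ) ‖z i‖ (by positivity) g1
        have g5 := mul_le_mul_of_nonneg_left g4 (norm_nonneg (fi i))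
        show ‖fi i‖ * m i ((k : ℕ) * δ) + ε - fi i (y i) < φ z
        linarith
      have hv' := convexHull_min hsub (convex_halfSpace_gt φ.toLinearMap.isLinear _) hv
      replace hv' : ‖fi i‖ * m i ((k : ℕ) * δ) + ε - fi i (y i) < φ v := hv'
      have h5 : fi i (y i + A i (v i)) ≤ ‖fi i‖ * ‖y i + A i (v i)‖ :=
        (le_abs_self _).trans ((fi i).le_opNorm _)
      rw [hφ] at h5
      by_contra hlt
      rw [not_le] at hlt
      have h6 := mul_le_mul_of_nonneg_left hlt.le (norm_nonneg (fi i))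
      have h7 := mul_le_mul_of_nonneg_right (hfi i) hε.le
      linarith
  -- rank of `B`
  have hΩ0 : (0 : Ordinal.{v}) < ω ^ ξ := opow_pos _ omega0_pos
  obtain ⟨hΩ, hΩ'⟩ := treeRank_spec hrank hΩ0
  have hRk : Rk N B (ω ^ ξ) [] := by
    refine Rk_of_tree hT N B x (fun t ζ h => hxN t ζ h) ?_ ?_ _ hΩ'
    · intro t ht l hl
      refine ⟨fun z hz => ?_, ?_⟩
      · obtain ⟨s, hs, hst, rfl⟩ := hl z hz
        refine hxσ s (hT.2 _ _ ht (hst.map _) (by simpa using hs))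
      · obtain ⟨f, hf, hf'⟩ := exists_functional (s := (fun v => y + Aop v) ''
          convexHull ℝ (branchSet x t)) (by
            have h1 := ((convex_convexHull ℝ (branchSet x t)).linear_image
              Aop.toLinearMap).translate y
            rwa [Set.image_image] at h1) hb0 (by
            rintro _ ⟨v, hv, rfl⟩
            exact hbranch t ht v hv)
        exact ⟨f, hf, fun z hz => hf' _ ⟨z, subset_convexHull ℝ _ (hl z hz), rfl⟩⟩
    · exact ⟨by simp, 0, by simp, by simp⟩
  obtain ⟨⟨⟨i, hi⟩, k⟩, hRc⟩ := ramsey hr N hN B Bc hpre hbase ξ hRk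
  obtain ⟨x', hx'N, hx'B⟩ := tree_of_Rk hT N (Bc (⟨i, hi⟩, k)) _ hΩ hRc
  -- contradiction with admissibility of `A i`
  have hk0 : 0 ≤ ((k : ℕ) : ℝ) * δ := by positivity
  have hfinal := hadm i (((k : ℕ) + 1) * δ) (by positivity) (y i) Λ D r T (fun t => x' t i)
    hD hr hT hrank (by
      intro t ht
      obtain ⟨l, hl, hl'⟩ := hx'B t ht
      have htne : t ≠ [] := by rintro rfl; exact hT.1 ht
      exact hl.1 _ (hl' _ ⟨t, htne, List.prefix_rfl, rfl⟩)) (by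
      intro t ζ h f
      exact hx'N t ζ h (f.comp (lp.evalCLM ℝ X (ENNReal.ofReal p) i)))
  have hlow : (m i ((k : ℕ) * δ) + ε) ^ p ≤ sInf {c : ℝ | ∃ t ∈ TD T D,
      ∃ v ∈ convexHull ℝ (branchSet (fun t => x' t i) t), c = ‖y i + A i v‖ ^ p} := by
    refine le_csInf ?_ ?_
    · obtain ⟨t, ht⟩ := hΩ' 0 hΩ0
      rw [derivIter_zero] at ht
      have htne : t ≠ [] := by rintro rfl; exact hT.1 ht
      let t' : List (Λ × D) := t.map fun a => (a, Classical.arbitrary D)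
      refine ⟨_, t', ?_, x' t' i, subset_convexHull ℝ _ ⟨t', ?_, List.prefix_rfl, rfl⟩, rfl⟩
      · simpa [TD, t', Function.comp_def] using ht
      · simpa [t'] using htne
    · rintro c ⟨t, ht, v, hv, rfl⟩
      have h1 : branchSet (fun t => x' t i) t =
          (lp.evalCLM ℝ X (ENNReal.ofReal p) i).toLinearMap '' branchSet x' t := by
        ext z
        constructor
        · rintro ⟨s, h1, h2, rfl⟩
          exact ⟨x' s, ⟨s, h1, h2, rfl⟩, rfl⟩
        · rintro ⟨_, ⟨s, h1, h2, rfl⟩, rfl⟩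
          exact ⟨s, h1, h2, rfl⟩
      rw [h1, ← LinearMap.image_convexHull] at hv
      obtain ⟨v', hv', rfl⟩ := hv
      obtain ⟨l, hl, hl'⟩ := hx'B t ht
      have h2 := hl.2 v' (convexHull_mono hl' hv')
      exact Real.rpow_le_rpow (add_nonneg (hm0 i _ hk0) hε.le) h2 hp0.le
  have h1 := hlow.trans hfinal
  have h2 := Real.rpow_le_rpow (by have := hm0 i _ hk0; positivity) h1
    (by positivity : 0 ≤ 1 / p)
  rw [← Real.rpow_mul (add_nonneg (hm0 i _ hk0) hε.le), mul_one_div_cancel hp0.ne',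
    Real.rpow_one, ← Real.mul_rpow hC.le (by positivity)] at h2
  have h3 := minkowski_two hp (norm_nonneg (y i)) (s := C * ((k : ℕ) * δ)) (d := C * δ)
    (by positivity) (by positivity)
  have h4 : C * ((((k : ℕ) : ℝ) + 1) * δ) = C * ((k : ℕ) * δ) + C * δ := by ring
  rw [h4] at h2
  simp only [m] at h2
  linarith

/-- the `ℓ_p`-direct sum of uniformly bounded operators satisfies
`t_{ξ,p}(A) ≤ sup_i max{t_{ξ,p}(Aᵢ), ‖Aᵢ‖}`. -/
theorem tConst_lp_directSum {I : Type} [Nonempty I] (ξ : Ordinal) (p : ℝ) (hp : 1 < p)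
    [Fact (1 ≤ ENNReal.ofReal p)]
    {X Y : I → Type*} [∀ i, NormedAddCommGroup (X i)] [∀ i, NormedSpace ℝ (X i)]
    [∀ i, NormedAddCommGroup (Y i)] [∀ i, NormedSpace ℝ (Y i)]
    (A : ∀ i, X i →L[ℝ] Y i) (M : ℝ) (hM : ∀ i, ‖A i‖ ≤ M)
    (Aop : lp X (ENNReal.ofReal p) →L[ℝ] lp Y (ENNReal.ofReal p))
    (hAop : ∀ (x : lp X (ENNReal.ofReal p)) (i : I),
      (Aop x : ∀ i, Y i) i = A i ((x : ∀ i, X i) i)) :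
    tConst ξ p Aop ≤ ⨆ i, max (tConst ξ p (A i)) (ENNReal.ofReal ‖A i‖) := by
  refine le_of_forall_gt_imp_ge_of_dense fun c hc => ?_
  rcases eq_or_ne c ⊤ with rfl | hct
  · exact le_top
  have hc0 : 0 < c := pos_of_gt hc
  have hC : 0 < c.toReal := ENNReal.toReal_pos hc0.ne' hct
  have hi : ∀ i, max (tConst ξ p (A i)) (ENNReal.ofReal ‖A i‖) < c := fun i =>
    (le_iSup (fun i => max (tConst ξ p (A i)) (ENNReal.ofReal ‖A i‖)) i).trans_lt hc
  have hadm : tAdmissible ξ p Aop c.toReal := by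
    refine tAdmissible_directSum ξ p hp A Aop hAop c.toReal hC (fun i => ?_) (fun i => ?_)
    · exact (ENNReal.ofReal_le_iff_le_toReal hct).1 ((le_max_right _ _).trans (hi i).le)
    · obtain ⟨e, ⟨C', hC'0, hC', rfl⟩, hlt⟩ := sInf_lt_iff.1 ((le_max_left _ _).trans_lt (hi i))
      have hle : C' ≤ c.toReal := (ENNReal.ofReal_le_iff_le_toReal hct).1 hlt.le
      intro σ hσ y Λ D r T x h1 h2 h3 h4 h5 h6
      refine (hC' σ hσ y Λ D r T x h1 h2 h3 h4 h5 h6).trans ?_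
      have hp0 : 0 ≤ p := by linarith
      gcongr
  exact sInf_le ⟨c.toReal, hC, hadm, (ENNReal.ofReal_toReal hct).symm⟩

end PaperAUS
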